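/- arXiv:2211.01843 — 4 statements merged into one kernel-verified Lean document; each statement's English description precedes it below -/
import Mathlib

section
/- Let θ be a substitution of constant length ℓ on a finite alphabet A, and for m ≥ 1 let M_m denote the submonoid of the monoid of all maps A → A under composition generated by {(θ^m)_i : 0 ≤ i < ℓ^m}. Then there exists N ≥ 1 such that M_N ⊆ M_m for every m ≥ 1; consequently the semigroup of the substitution S_θ := ⋂_{m≥1} M_m equals M_N. -/
/-- Column maps of powers of a length-`ℓ` substitution with column maps `θ i`:
`(θ^0)_i = id` and `(θ^{m+1})_{ℓq+r} = θ_r ∘ (θ^m)_q` for `0 ≤ r ≤ ℓ−1`. -/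
def powCol {A : Type*} (ℓ : ℕ) (θ : ℕ → A → A) : ℕ → ℕ → A → A
  | 0, _ => id
  | m + 1, i => θ (i % ℓ) ∘ powCol ℓ θ m (i / ℓ)

/-- The submonoid `M_m` of maps `A → A` (under composition, i.e. in `Function.End A`)
generated by the column maps of `θ^m`. -/
def colMonoid {A : Type*} (ℓ : ℕ) (θ : ℕ → A → A) (m : ℕ) : Submonoid (Function.End A) :=
  Submonoid.closure {f : Function.End A | ∃ i, i < ℓ ^ m ∧ f = powCol ℓ θ m i}

theorem powCol_add {A : Type*} (ℓ : ℕ) (θ : ℕ → A → A) (m n i : ℕ) :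
    powCol ℓ θ (m + n) i = powCol ℓ θ n (i % ℓ ^ n) ∘ powCol ℓ θ m (i / ℓ ^ n) := by
  induction n generalizing i with
  | zero => simp [powCol]
  | succ n ih =>
    rw [← Nat.add_assoc, powCol, powCol, ih, pow_succ', Nat.mod_mul_right_div_self,
      Nat.mod_mul_right_mod, Nat.div_div_eq_div_mul, Function.comp_assoc]

theorem powCol_mem_colMonoid {A : Type*} (ℓ : ℕ) (θ : ℕ → A → A) {m i : ℕ} (hi : i < ℓ ^ m) :
    (powCol ℓ θ m i : Function.End A) ∈ colMonoid ℓ θ m :=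
  Submonoid.subset_closure ⟨i, hi, rfl⟩

theorem powCol_mul_mem_colMonoid {A : Type*} {ℓ : ℕ} (hℓ : 0 < ℓ) (θ : ℕ → A → A) (m k : ℕ)
    {i : ℕ} (hi : i < ℓ ^ (m * k)) :
    (powCol ℓ θ (m * k) i : Function.End A) ∈ colMonoid ℓ θ m := by
  induction k generalizing i with
  | zero => exact (colMonoid ℓ θ m).one_mem
  | succ k ih =>
    rw [Nat.mul_succ, powCol_add]
    refine (colMonoid ℓ θ m).mul_mem
      (powCol_mem_colMonoid ℓ θ (Nat.mod_lt _ (pow_pos hℓ m))) (ih ?_)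
    rwa [Nat.div_lt_iff_lt_mul (pow_pos hℓ m), ← pow_add]

theorem colMonoid_le_of_dvd {A : Type*} {ℓ : ℕ} (hℓ : 0 < ℓ) (θ : ℕ → A → A) {m n : ℕ}
    (h : m ∣ n) : colMonoid ℓ θ n ≤ colMonoid ℓ θ m := by
  obtain ⟨k, rfl⟩ := h
  refine Submonoid.closure_le.2 ?_
  rintro _ ⟨i, hi, rfl⟩
  exact powCol_mul_mem_colMonoid hℓ θ m k hi

/-- There exists `N ≥ 1` with `M_N ⊆ M_m` for every `m ≥ 1`; consequently
the semigroup of the substitution `S_θ = ⋂_{m ≥ 1} M_m` equals `M_N`. -/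
theorem stmt7 {A : Type*} [Fintype A] (ℓ : ℕ) (hℓ : 2 ≤ ℓ) (θ : ℕ → A → A) :
    ∃ N : ℕ, 1 ≤ N ∧ (∀ m : ℕ, 1 ≤ m → colMonoid ℓ θ N ≤ colMonoid ℓ θ m) ∧
      (⨅ (m : ℕ) (_ : 1 ≤ m), colMonoid ℓ θ m) = colMonoid ℓ θ N := by
  have hpos : 0 < ℓ := by omega
  have : Finite (Function.End A) := inferInstanceAs (Finite (A → A))
  have : Finite (Submonoid (Function.End A)) :=
    Finite.of_injective _ (SetLike.coe_injective (A := Submonoid (Function.End A)))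
  obtain ⟨N, hN, hmin⟩ :=
    (Set.toFinite (colMonoid ℓ θ '' Set.Ici 1)).exists_minimalFor' (colMonoid ℓ θ) (Set.Ici 1)
      ⟨1, Set.self_mem_Ici⟩
  have hle : ∀ m : ℕ, 1 ≤ m → colMonoid ℓ θ N ≤ colMonoid ℓ θ m := fun m hm =>
    (hmin (Nat.mul_pos hN hm) (colMonoid_le_of_dvd hpos θ (Nat.dvd_mul_right N m))).trans
      (colMonoid_le_of_dvd hpos θ (Nat.dvd_mul_left m N))
  exact ⟨N, hN, hle, le_antisymm (iInf₂_le N hN) (le_iInf₂ hle)⟩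
end

section
/- Let θ be a substitution of constant length ℓ on a finite alphabet A and let u ∈ A^ℤ be a two-sided fixed point of θ. Let M be the submonoid of maps A → A under composition generated by {θ_0,…,θ_{ℓ−1}}. Then the ℓ-kernel of u equals the set of sequences obtained by applying elements of M entrywise to u: ker_ℓ(u) = { (s(u_n))_{n∈ℤ} : s ∈ M }. -/
/-- Subsampling `u` along `ℓ ^ e * n + j` is the entrywise action of a composition of
column maps. -/
theorem exists_mem_closure_columns {A : Type*} {ℓ : ℕ} (hℓ : 0 < ℓ)
    {θ : ℕ → A → A} {u : ℤ → A}
    (hfix : ∀ (q : ℤ) (r : ℕ), r < ℓ → u ((ℓ : ℤ) * q + (r : ℤ)) = θ r (u q)) (e : ℕ) :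
    ∀ j < ℓ ^ e, ∃ s ∈ Submonoid.closure {f : Function.End A | ∃ i, i < ℓ ∧ f = θ i},
      ∀ n : ℤ, u ((ℓ : ℤ) ^ e * n + (j : ℤ)) = s (u n) := by
  induction e with
  | zero =>
    intro j hj
    obtain rfl : j = 0 := by simpa using hj
    exact ⟨1, one_mem _, fun n => by simp [Function.End.one_def]⟩
  | succ e ih =>
    intro j hj
    obtain ⟨s, hs, hsu⟩ := ih (j / ℓ) (Nat.div_lt_of_lt_mul (by rwa [← pow_succ']))
    have hr : j % ℓ < ℓ := Nat.mod_lt _ hℓ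
    refine ⟨(show Function.End A from θ (j % ℓ)) * s,
      mul_mem (Submonoid.subset_closure ⟨_, hr, rfl⟩) hs, fun n => ?_⟩
    have hj' : (j : ℤ) = ℓ * ((j / ℓ : ℕ) : ℤ) + ((j % ℓ : ℕ) : ℤ) := by
      exact_mod_cast (Nat.div_add_mod j ℓ).symm
    have hidx : (ℓ : ℤ) ^ (e + 1) * n + j
        = ℓ * ((ℓ : ℤ) ^ e * n + ((j / ℓ : ℕ) : ℤ)) + ((j % ℓ : ℕ) : ℤ) := by
      rw [hj', pow_succ]
      ring
    rw [hidx, hfix _ _ hr, hsu]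
    rfl

/-- The entrywise action of a composition of column maps on `u` is a subsampling of `u`. -/
theorem exists_subsampling_of_mem_closure_columns {A : Type*} {ℓ : ℕ}
    {θ : ℕ → A → A} {u : ℤ → A}
    (hfix : ∀ (q : ℤ) (r : ℕ), r < ℓ → u ((ℓ : ℤ) * q + (r : ℤ)) = θ r (u q))
    {s : Function.End A}
    (hs : s ∈ Submonoid.closure {f : Function.End A | ∃ i, i < ℓ ∧ f = θ i}) :
    ∃ e j : ℕ, j < ℓ ^ e ∧ ∀ n : ℤ, s (u n) = u ((ℓ : ℤ) ^ e * n + (j : ℤ)) := by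
  induction hs using Submonoid.closure_induction_left with
  | one => exact ⟨0, 0, by simp, fun n => by simp [Function.End.one_def]⟩
  | mul_left f hf t _ ih =>
    obtain ⟨i, hi, rfl⟩ := hf
    obtain ⟨e, j, hj, htu⟩ := ih
    refine ⟨e + 1, ℓ * j + i, ?_, fun n => ?_⟩
    · calc ℓ * j + i < ℓ * (j + 1) := by rw [mul_add_one]; gcongr
        _ ≤ ℓ * ℓ ^ e := Nat.mul_le_mul_left ℓ hj
        _ = ℓ ^ (e + 1) := (pow_succ' ℓ e).symm
    · change θ i (t (u n)) = _
      rw [htu, ← hfix _ _ hi]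
      congr 1
      push_cast
      ring

/-- For a two-sided fixed point `u` of a length-`ℓ` substitution with
column maps `θ i`, the `ℓ`-kernel of `u`,
`ker_ℓ(u) = { (u_{ℓ^e·n+j})_{n∈ℤ} : e ≥ 0, 0 ≤ j ≤ ℓ^e − 1 }`, equals the set of
sequences `(s(u_n))_{n∈ℤ}` where `s` ranges over the submonoid `M` of maps `A → A`
(under composition) generated by `{θ_0, …, θ_{ℓ−1}}`. -/
theorem stmt8 {A : Type*} [Fintype A] (ℓ : ℕ) (hℓ : 2 ≤ ℓ)
    (θ : ℕ → A → A) (u : ℤ → A)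
    (hfix : ∀ (q : ℤ) (r : ℕ), r < ℓ → u ((ℓ : ℤ) * q + (r : ℤ)) = θ r (u q)) :
    {v : ℤ → A | ∃ e j : ℕ, j < ℓ ^ e ∧ v = fun n : ℤ => u ((ℓ : ℤ) ^ e * n + (j : ℤ))}
      = {v : ℤ → A |
          ∃ s ∈ Submonoid.closure {f : Function.End A | ∃ i, i < ℓ ∧ f = θ i},
            v = fun n : ℤ => s (u n)} := by
  ext v
  constructor
  · rintro ⟨e, j, hj, rfl⟩
    obtain ⟨s, hs, hsu⟩ := exists_mem_closure_columns (by omega) hfix e j hj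
    exact ⟨s, hs, funext hsu⟩
  · rintro ⟨s, hs, rfl⟩
    obtain ⟨e, j, hj, hsu⟩ := exists_subsampling_of_mem_closure_columns hfix hs
    exact ⟨e, j, hj, funext hsu⟩
end

section
/- Let θ be a substitution of constant length ℓ on a finite alphabet A in simplified form, and let u ∈ A^ℤ be a two-sided fixed point of θ. Consider the automaton whose states are the elements of the submonoid M of maps A → A generated by {θ_0,…,θ_{ℓ−1}}, with initial state the identity map id, transition map δ(s, i) = s ∘ θ_i for 0 ≤ i ≤ ℓ−1, and output maps ω_r(s) = s(u_0) and ω_l(s) = s(u_{−1}). Then this automaton generates u in reverse reading: for every n ≥ 0 with base-ℓ digits n_0,…,n_k (least significant first, n = Σ n_i ℓ^i), feeding n_0, then n_1, …, then n_k from the state id yields a state s with ω_r(s) = s(u_0) = u_n; and for every n < 0 written as n = Σ_{i=0}^k n_i ℓ^i − ℓ^{k+1} with 0 ≤ n_i ≤ ℓ−1, feeding n_0,…,n_k and then the digit ℓ−1 from the state id yields a state s with ω_l(s) = s(u_{−1}) = u_n. -/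
/-- Feeding digits below `ℓ` keeps the state in the monoid generated by the column maps. -/
theorem foldl_comp_mem_closure {A : Type*} (ℓ : ℕ) (θ : ℕ → A → A) (ds : List ℕ)
    (hds : ∀ d ∈ ds, d < ℓ) (s : Function.End A)
    (hs : s ∈ Submonoid.closure {f : Function.End A | ∃ i, i < ℓ ∧ f = θ i}) :
    ds.foldl (fun (s : Function.End A) (i : ℕ) => s ∘ θ i) s ∈
      Submonoid.closure {f : Function.End A | ∃ i, i < ℓ ∧ f = θ i} := by
  induction ds generalizing s with
  | nil => exact hs
  | cons d ds ih =>
    exact ih (fun x hx => hds x (List.mem_cons_of_mem _ hx)) _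
      (mul_mem hs (Submonoid.subset_closure ⟨d, hds d List.mem_cons_self, rfl⟩))

/-- Feeding digits below `ℓ` and evaluating at `u m` reads off the fixed point `u` at the
position with these low-order digits and quotient `m`. -/
theorem foldl_comp_apply_of_fixed {A : Type*} (ℓ : ℕ) (θ : ℕ → A → A) (u : ℤ → A)
    (hfix : ∀ (q : ℤ) (r : ℕ), r < ℓ → u ((ℓ : ℤ) * q + (r : ℤ)) = θ r (u q))
    (m : ℤ) (ds : List ℕ) (hds : ∀ d ∈ ds, d < ℓ) (s : Function.End A) :
    (ds.foldl (fun (s : Function.End A) (i : ℕ) => s ∘ θ i) s) (u m) =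
      s (u (((Nat.ofDigits ℓ ds : ℕ) : ℤ) + (ℓ : ℤ) ^ ds.length * m)) := by
  induction ds generalizing s with
  | nil => exact congrArg s (congrArg u (by simp))
  | cons d ds ih =>
    refine (ih (fun x hx => hds x (List.mem_cons_of_mem _ hx)) _).trans (congrArg s ?_)
    refine (hfix _ d (hds d List.mem_cons_self)).symm.trans (congrArg u ?_)
    rw [Nat.ofDigits_cons, List.length_cons]
    push_cast
    ring


/-- Let `θ` be a length-`ℓ` substitution in simplified form with
two-sided fixed point `u`. The automaton with states the submonoid `M` of maps
`A → A` generated by `{θ_0, …, θ_{ℓ−1}}`, initial state `id`, transitions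
`δ(s, i) = s ∘ θ_i`, and outputs `ω_r(s) = s(u_0)`, `ω_l(s) = s(u_{−1})`, generates
`u` in reverse reading: feeding the base-`ℓ` digits `n_0, …, n_k` of `n ≥ 0` (least
significant first) from `id` yields a state `s ∈ M` with `s(u_0) = u_n`; and for
`n < 0` written `n = Σ n_i ℓ^i − ℓ^{k+1}`, feeding `n_0, …, n_k` and then `ℓ−1`
from `id` yields a state `s ∈ M` with `s(u_{−1}) = u_n`. -/
theorem stmt12 {A : Type*} [Fintype A] (ℓ : ℕ) (hℓ : 2 ≤ ℓ)
    (θ : ℕ → A → A)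
    (hsimp0 : θ 0 ∘ θ 0 = θ 0) (hsimpl : θ (ℓ - 1) ∘ θ (ℓ - 1) = θ (ℓ - 1))
    (u : ℤ → A)
    (hfix : ∀ (q : ℤ) (r : ℕ), r < ℓ → u ((ℓ : ℤ) * q + (r : ℤ)) = θ r (u q)) :
    (∀ (n : ℕ) (ds : List ℕ), ds ≠ [] → (∀ d ∈ ds, d < ℓ) → n = Nat.ofDigits ℓ ds →
      (ds.foldl (fun (s : Function.End A) (i : ℕ) => s ∘ θ i) (id : Function.End A) ∈
          Submonoid.closure {f : Function.End A | ∃ i, i < ℓ ∧ f = θ i}) ∧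
      (ds.foldl (fun (s : Function.End A) (i : ℕ) => s ∘ θ i) (id : Function.End A)) (u 0)
        = u (n : ℤ)) ∧
    (∀ (n : ℤ) (ds : List ℕ), n < 0 → (∀ d ∈ ds, d < ℓ) →
      n = (Nat.ofDigits ℓ ds : ℤ) - (ℓ : ℤ) ^ ds.length →
      ((ds ++ [ℓ - 1]).foldl (fun (s : Function.End A) (i : ℕ) => s ∘ θ i)
          (id : Function.End A) ∈
          Submonoid.closure {f : Function.End A | ∃ i, i < ℓ ∧ f = θ i}) ∧
      ((ds ++ [ℓ - 1]).foldl (fun (s : Function.End A) (i : ℕ) => s ∘ θ i)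
          (id : Function.End A)) (u (-1)) = u n) := by
  refine ⟨fun n ds _ hds hn => ⟨foldl_comp_mem_closure ℓ θ ds hds _ (one_mem _), ?_⟩,
    fun n ds _ hds hn => ?_⟩
  · refine (foldl_comp_apply_of_fixed ℓ θ u hfix 0 ds hds _).trans (congrArg u ?_)
    rw [hn, mul_zero, add_zero]
  · have hds' : ∀ d ∈ ds ++ [ℓ - 1], d < ℓ := by
      intro d hd
      rcases List.mem_append.1 hd with h | h
      · exact hds d h
      · rw [List.mem_singleton.1 h]
        omega
    refine ⟨foldl_comp_mem_closure ℓ θ _ hds' _ (one_mem _), ?_⟩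
    refine (foldl_comp_apply_of_fixed ℓ θ u hfix (-1) _ hds' _).trans (congrArg u ?_)
    rw [hn, ← Nat.coe_ofDigits, Nat.ofDigits_append, List.length_append, Nat.ofDigits_singleton,
      List.length_singleton]
    push_cast [show 1 ≤ ℓ by omega]
    ring
end

section
/- Let θ be a substitution of constant length ℓ on a finite alphabet A in simplified form and let u ∈ A^ℤ be a two-sided fixed point of θ. If, for some n ∈ ℤ, both θ_{(n)} and θ_{(n − ℓ^{|n|_ℓ})} equal the constant map with value u_n, then u_{n + m·ℓ^{|n|_ℓ}} = u_n for all m ∈ ℤ; in particular n ∈ Per(u). -/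
/-- The canonical base-`ℓ` digit word for `n : ℤ` (least significant first). For
`n ≥ 0` these are the base-`ℓ` digits of `n` (`[0]` for `n = 0`); for `n < 0`,
written canonically `n = Σ_{i=0}^k n_i ℓ^i − ℓ^{k+1}` with digit list empty or
`n_k ≠ ℓ−1`, the word is `n_0 ⋯ n_k (ℓ−1)`. -/
def thetaWord (ℓ : ℕ) (n : ℤ) : List ℕ :=
  if 0 ≤ n then (if n = 0 then [0] else Nat.digits ℓ n.toNat)
  else ((Nat.digits ℓ (-n - 1).toNat).map fun d => ℓ - 1 - d) ++ [ℓ - 1]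

/-- The extended column map `θ_{(n)}`: for `n ≥ 0` with digits `n_0, …, n_{j−1}`,
`θ_{(n)} = θ_{n_0} ∘ ⋯ ∘ θ_{n_{j−1}}`; for `n < 0` written canonically
`n = Σ n_i ℓ^i − ℓ^{k+1}`, `θ_{(n)} = θ_{n_0} ∘ ⋯ ∘ θ_{n_k} ∘ θ_{ℓ−1}`. -/
def thetaCol {A : Type*} (ℓ : ℕ) (θ : ℕ → A → A) (n : ℤ) : A → A :=
  (thetaWord ℓ n).foldr (fun (i : ℕ) (f : A → A) => θ i ∘ f) id

/-- `|n|_ℓ`: for `n ≥ 0` the minimal `j ≥ 1` with `n < ℓ^j`; for `n < 0` written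
canonically with digit list `n_0 ⋯ n_k`, it is `k + 2`. -/
def lenL (ℓ : ℕ) (n : ℤ) : ℕ := (thetaWord ℓ n).length

/-- Every digit of the canonical word is smaller than the base. -/
theorem lt_of_mem_thetaWord {ℓ : ℕ} (hℓ : 2 ≤ ℓ) {n : ℤ} {d : ℕ} (hd : d ∈ thetaWord ℓ n) :
    d < ℓ := by
  unfold thetaWord at hd
  split_ifs at hd with h h0
  · simp only [List.mem_singleton] at hd
    omega
  · exact Nat.digits_lt_base (by omega) hd
  · simp only [List.mem_append, List.mem_map, List.mem_singleton] at hd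
    rcases hd with ⟨a, -, rfl⟩ | rfl <;> omega

/-- A word and its digitwise complement sum to `ℓ ^ length - 1`. -/
theorem ofDigits_map_complement {ℓ : ℕ} (w : List ℕ) (hw : ∀ d ∈ w, d < ℓ) :
    ((Nat.ofDigits ℓ (w.map fun d => ℓ - 1 - d) : ℕ) : ℤ) + ((Nat.ofDigits ℓ w : ℕ) : ℤ) + 1
      = (ℓ : ℤ) ^ w.length := by
  induction w with
  | nil => simp
  | cons d w ih =>
    have hd : d < ℓ := hw d (by simp)
    have ih := ih fun a ha => hw a (by simp [ha])
    have hc : ((ℓ - 1 - d : ℕ) : ℤ) = ℓ - 1 - d := by omega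
    simp only [List.map_cons, Nat.ofDigits_cons, List.length_cons, pow_succ, Nat.cast_add,
      Nat.cast_mul, hc]
    rw [← ih]
    ring

/-- The canonical word of `n` represents `n` modulo `ℓ ^ |n|_ℓ`. -/
theorem exists_ofDigits_thetaWord {ℓ : ℕ} (hℓ : 2 ≤ ℓ) (n : ℤ) :
    ∃ c : ℤ, ((Nat.ofDigits ℓ (thetaWord ℓ n) : ℕ) : ℤ) = n + c * (ℓ : ℤ) ^ lenL ℓ n := by
  unfold lenL thetaWord
  split_ifs with h h0
  · exact ⟨0, by simp [h0]⟩
  · refine ⟨0, ?_⟩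
    rw [Nat.ofDigits_digits]
    omega
  · refine ⟨1, ?_⟩
    have hs := ofDigits_map_complement (ℓ := ℓ) (Nat.digits ℓ (-n - 1).toNat)
      fun d hd => Nat.digits_lt_base (by omega) hd
    rw [Nat.ofDigits_digits] at hs
    have ht : (((-n - 1).toNat : ℕ) : ℤ) = -n - 1 := by omega
    have hc : ((ℓ - 1 : ℕ) : ℤ) = ℓ - 1 := by omega
    rw [ht] at hs
    simp only [Nat.ofDigits_append, Nat.ofDigits_singleton, Nat.cast_add, Nat.cast_mul,
      Nat.cast_pow, List.length_append, List.length_map, List.length_singleton, pow_succ, hc]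
    linear_combination hs

/-- Iterating the fixed-point relation along a word of digits. -/
theorem fixedPoint_ofDigits {A : Type*} {ℓ : ℕ} {θ : ℕ → A → A} {u : ℤ → A}
    (hfix : ∀ (q : ℤ) (r : ℕ), r < ℓ → u ((ℓ : ℤ) * q + (r : ℤ)) = θ r (u q))
    (w : List ℕ) (hw : ∀ d ∈ w, d < ℓ) (q : ℤ) :
    u (((Nat.ofDigits ℓ w : ℕ) : ℤ) + q * (ℓ : ℤ) ^ w.length)
      = w.foldr (fun (i : ℕ) (f : A → A) => θ i ∘ f) id (u q) := by
  induction w with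
  | nil => simp
  | cons d w ih =>
    simp only [List.foldr_cons, Function.comp_apply]
    rw [← ih fun a ha => hw a (by simp [ha]), ← hfix _ d (hw d (by simp)), Nat.ofDigits_cons,
      List.length_cons, Nat.cast_add, Nat.cast_mul]
    congr 1
    ring

/-- Let `θ` be a length-`ℓ` substitution in simplified form and `u` a
two-sided fixed point of `θ`. If both `θ_{(n)}` and `θ_{(n − ℓ^{|n|_ℓ})}` are the
constant map with value `u_n`, then `u_{n + m·ℓ^{|n|_ℓ}} = u_n` for all `m : ℤ`;
in particular `n ∈ Per(u)`. -/
theorem stmt15 {A : Type*} [Fintype A] (ℓ : ℕ) (hℓ : 2 ≤ ℓ)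
    (θ : ℕ → A → A)
    (hsimp0 : θ 0 ∘ θ 0 = θ 0) (hsimpl : θ (ℓ - 1) ∘ θ (ℓ - 1) = θ (ℓ - 1))
    (u : ℤ → A)
    (hfix : ∀ (q : ℤ) (r : ℕ), r < ℓ → u ((ℓ : ℤ) * q + (r : ℤ)) = θ r (u q)) :
    ∀ n : ℤ, thetaCol ℓ θ n = Function.const A (u n) →
      thetaCol ℓ θ (n - (ℓ : ℤ) ^ lenL ℓ n) = Function.const A (u n) →
      (∀ m : ℤ, u (n + m * (ℓ : ℤ) ^ lenL ℓ n) = u n) ∧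
      (∃ k : ℕ, 1 ≤ k ∧ ∀ n' : ℤ, n' ≡ n [ZMOD (k : ℤ)] → u n' = u n) := by
  intro n hn _
  obtain ⟨c, hc⟩ := exists_ofDigits_thetaWord hℓ n
  have key : ∀ m : ℤ, u (n + m * (ℓ : ℤ) ^ lenL ℓ n) = u n := fun m => by
    have h := fixedPoint_ofDigits hfix (thetaWord ℓ n) (fun _ => lt_of_mem_thetaWord hℓ) (m - c)
    rw [hc] at h
    calc u (n + m * (ℓ : ℤ) ^ lenL ℓ n)
        = u (n + c * (ℓ : ℤ) ^ lenL ℓ n + (m - c) * (ℓ : ℤ) ^ lenL ℓ n) := by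
          congr 1
          ring
      _ = thetaCol ℓ θ n (u (m - c)) := h
      _ = u n := by rw [hn, Function.const_apply]
  refine ⟨key, ℓ ^ lenL ℓ n, Nat.one_le_pow _ _ (by omega), fun n' hn' => ?_⟩
  obtain ⟨m, hm⟩ := hn'.symm.dvd
  rw [← key m]
  congr 1
  push_cast at hm
  linear_combination hm
end
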